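/- The group PL(I) admits no Polish group topology: there is no topology on PL(I) making it a topological group that is separable and completely metrizable. -/

import Mathlib

/-- The group of self-homeomorphisms of a space, with `(f * g) x = f (g x)`. -/
instance Homeomorph.instGroupSelfHomeo {M : Type*} [TopologicalSpace M] : Group (Homeomorph M M) where
  mul f g := g.trans f
  one := Homeomorph.refl M
  inv := Homeomorph.symm
  mul_assoc f g h := Homeomorph.ext fun _ => rfl
  one_mul f := Homeomorph.ext fun _ => rfl
  mul_one f := Homeomorph.ext fun _ => rfl
  inv_mul_cancel f := Homeomorph.ext fun x => f.symm_apply_apply x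

/-- The unit interval `[0,1]`. -/
abbrev UnitInt : Type := Set.Icc (0 : ℝ) 1

/-- `f` is an orientation-preserving piecewise linear homeomorphism of `[0,1]`:
it is strictly increasing and there is a finite partition `0 = t 0 < t 1 < ⋯ < t k = 1`
such that `f` is affine on each subinterval `[t i, t (i+1)]`. -/
def IsPLHomeo (f : Homeomorph UnitInt UnitInt) : Prop :=
  StrictMono f ∧
    ∃ (k : ℕ) (t : Fin (k + 1) → ℝ), t 0 = 0 ∧ t (Fin.last k) = 1 ∧ StrictMono t ∧
      ∀ i : Fin k, ∃ a b : ℝ, ∀ x : UnitInt,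
        (x : ℝ) ∈ Set.Icc (t i.castSucc) (t i.succ) → (f x : ℝ) = a * (x : ℝ) + b

/-- A strictly increasing continuous function fixing `0` and `1` induces a homeomorphism
of `[0,1]`. -/
theorem exists_homeomorph_unitInt {F : ℝ → ℝ} (hc : Continuous F) (hm : StrictMono F)
    (h0 : F 0 = 0) (h1 : F 1 = 1) :
    ∃ f : Homeomorph UnitInt UnitInt, StrictMono f ∧ ∀ x, (f x : ℝ) = F x := by
  let φ : UnitInt → UnitInt := fun x =>
    ⟨F x, h0.ge.trans (hm.monotone x.2.1), (hm.monotone x.2.2).trans h1.le⟩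
  have hφ : StrictMono φ := fun x y h => hm h
  have hs : Function.Surjective φ := by
    intro y
    have hy : (y : ℝ) ∈ Set.Icc (F 0) (F 1) := by rw [h0, h1]; exact y.2
    obtain ⟨x, hx, hxy⟩ := intermediate_value_Icc zero_le_one hc.continuousOn hy
    exact ⟨⟨x, hx⟩, Subtype.ext hxy⟩
  exact ⟨(hφ.orderIsoOfSurjective φ hs).toHomeomorph, hφ, fun x => rfl⟩

/-- There is an element of `PL(I)` that doubles all points of `[0,1/3]`. -/
theorem exists_isPLHomeo_doubling :
    ∃ d, IsPLHomeo d ∧ ∀ x : UnitInt, (x : ℝ) ≤ 1 / 3 → (d x : ℝ) = 2 * x := by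
  obtain ⟨d, hd, hdF⟩ := exists_homeomorph_unitInt (F := fun x => min (2 * x) ((1 + x) / 2))
    (by fun_prop)
    (fun x y h => by
      have : x < y := h
      exact lt_min (min_lt_of_left_lt (by linarith)) (min_lt_of_right_lt (by linarith)))
    (by norm_num) (by norm_num)
  refine ⟨d, ⟨hd, 2, ![0, 1 / 3, 1], rfl, rfl, ?_, ?_⟩, fun x hx => ?_⟩
  · rw [Fin.strictMono_iff_lt_succ]
    simp [Fin.forall_fin_succ]
    norm_num
  · simp only [Fin.forall_fin_succ, IsEmpty.forall_iff, and_true]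
    refine ⟨⟨2, 0, fun x hx => ?_⟩, ⟨1 / 2, 1 / 2, fun x hx => ?_⟩⟩
    · have : (x : ℝ) ≤ 1 / 3 := hx.2
      rw [hdF, min_eq_left (by linarith)]; ring
    · have : 1 / 3 ≤ (x : ℝ) := hx.1
      rw [hdF, min_eq_right (by linarith)]; ring
  · rw [hdF, min_eq_left (by linarith)]

/-- For `0 < a < b < 1` and `s > 1` there is an element of `PL(I)` supported on `[a,b]`, moving
every point of `(a,b)`, and with slope `s` to the right of `a`. -/
theorem exists_isPLHomeo_bump {a b s : ℝ} (ha : 0 < a) (hab : a < b) (hb : b < 1) (hs : 1 < s) :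
    ∃ f, IsPLHomeo f ∧ (∀ x : UnitInt, (x : ℝ) ≤ a ∨ b ≤ x → f x = x) ∧
      (∀ x : UnitInt, a < x → (x : ℝ) < b → x < f x) ∧
      ∀ x : UnitInt, a ≤ x → (x : ℝ) ≤ (b + a * s) / (s + 1) → (f x : ℝ) = a + s * (x - a) := by
  obtain ⟨r, hr0, hr1, hsr⟩ : ∃ r : ℝ, 0 < r ∧ r < 1 ∧ s * r = 1 :=
    ⟨s⁻¹, by positivity, inv_lt_one_of_one_lt₀ hs, mul_inv_cancel₀ (by positivity)⟩
  set m := (b + a * s) / (s + 1) with hmdef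
  have hm : m * (s + 1) = b + a * s := by rw [hmdef]; field_simp
  have ham : a < m := by nlinarith
  have hmb : m < b := by nlinarith
  have hlow : ∀ x, x ≤ m → a + s * (x - a) ≤ b - r * (b - x) := by
    intro x hx
    have h1 : s * (x - a) - (b - x) ≤ (s - 1) * (m - a) := by nlinarith
    have h2 : b - m = s * (m - a) := by linarith
    have h3 : r * (b - m) = m - a := by rw [h2, ← mul_assoc, mul_comm r, hsr, one_mul]
    nlinarith
  have hhigh : ∀ x, m ≤ x → b - r * (b - x) ≤ a + s * (x - a) := by
    intro x hx
    have h2 : b - m = s * (m - a) := by linarith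
    have h3 : r * (b - m) = m - a := by rw [h2, ← mul_assoc, mul_comm r, hsr, one_mul]
    nlinarith
  have hleft : ∀ x, x ≤ a → max x (min (a + s * (x - a)) (b - r * (b - x))) = x := fun x hx =>
    max_eq_left (min_le_of_left_le (by nlinarith))
  have hright : ∀ x, b ≤ x → max x (min (a + s * (x - a)) (b - r * (b - x))) = x := fun x hx =>
    max_eq_left (min_le_of_right_le (by nlinarith))
  have hmid₁ : ∀ x, a ≤ x → x ≤ m →
      max x (min (a + s * (x - a)) (b - r * (b - x))) = a + s * (x - a) := fun x h1 h2 => by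
    rw [min_eq_left (hlow x h2), max_eq_right (by nlinarith)]
  have hmid₂ : ∀ x, m ≤ x → x ≤ b →
      max x (min (a + s * (x - a)) (b - r * (b - x))) = b - r * (b - x) := fun x h1 h2 => by
    rw [min_eq_right (hhigh x h1), max_eq_right (by nlinarith)]
  obtain ⟨f, hf, hfF⟩ := exists_homeomorph_unitInt
    (F := fun x => max x (min (a + s * (x - a)) (b - r * (b - x)))) (by fun_prop)
    (fun x y h => by
      have : x < y := h
      exact max_lt (lt_max_of_lt_left h) (lt_max_of_lt_right
        (lt_min (min_lt_of_left_lt (by nlinarith)) (min_lt_of_right_lt (by nlinarith)))))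
    (hleft 0 ha.le) (hright 1 hb.le)
  refine ⟨f, ⟨hf, 4, ![0, a, m, b, 1], rfl, rfl, ?_, ?_⟩, ?_, fun x h1 h2 => ?_,
    fun x h1 h2 => ?_⟩
  · rw [Fin.strictMono_iff_lt_succ]
    simp [Fin.forall_fin_succ]
    exact ⟨ha, ham, hmb, hb⟩
  · simp only [Fin.forall_fin_succ, IsEmpty.forall_iff, and_true]
    refine ⟨⟨1, 0, fun x hx => ?_⟩, ⟨s, a - s * a, fun x hx => ?_⟩,
      ⟨r, b - r * b, fun x hx => ?_⟩, ⟨1, 0, fun x hx => ?_⟩⟩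
    · rw [hfF, hleft x hx.2]; ring
    · rw [hfF, hmid₁ x hx.1 hx.2]; ring
    · rw [hfF, hmid₂ x hx.1 hx.2]; ring
    · rw [hfF, hright x hx.1]; ring
  · rintro x (hx | hx)
    · exact Subtype.ext ((hfF x).trans (hleft x hx))
    · exact Subtype.ext ((hfF x).trans (hright x hx))
  · have : (x : ℝ) < f x := by
      rw [hfF]
      exact lt_max_of_lt_right (lt_min (by nlinarith) (by nlinarith))
    exact this
  · rw [hfF, hmid₁ x h1 h2]

/-- An element of `PL(I)` is linear near `0`. -/
theorem IsPLHomeo.exists_linear_near_zero {f : Homeomorph UnitInt UnitInt} (hf : IsPLHomeo f) :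
    ∃ c ε : ℝ, 0 < c ∧ 0 < ε ∧ ∀ x : UnitInt, (x : ℝ) ≤ ε → (f x : ℝ) = c * x := by
  obtain ⟨hm, k, t, h0, h1, ht, hlin⟩ := hf
  obtain _ | k := k
  · have : t 0 = 1 := h1
    linarith
  obtain ⟨c, e, hce⟩ := hlin 0
  have hε : 0 < t (Fin.succ 0) := h0 ▸ ht (Fin.succ_pos 0)
  have hε1 : t (Fin.succ 0) ≤ 1 := h1 ▸ ht.monotone (Fin.le_last _)
  have hlin0 : ∀ x : UnitInt, (x : ℝ) ≤ t (Fin.succ 0) → (f x : ℝ) = c * x + e := fun x hx =>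
    hce x ⟨by rw [Fin.castSucc_zero, h0]; exact x.2.1, hx⟩
  let z : UnitInt := ⟨0, by simp⟩
  have hz : (f z : ℝ) = 0 := by
    obtain ⟨y, hy⟩ := f.surjective z
    have : f z ≤ f y := hm.monotone (show z ≤ y from y.2.1)
    rw [hy] at this
    exact le_antisymm this (f z).2.1
  have he : e = 0 := by
    have := hlin0 z hε.le
    rw [hz] at this
    simpa [z] using this.symm
  subst he
  let w : UnitInt := ⟨t (Fin.succ 0), hε.le, hε1⟩
  have hw : (f z : ℝ) < f w := hm (show z < w from hε)
  rw [hz, hlin0 w le_rfl, add_zero] at hw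
  exact ⟨c, _, pos_of_mul_pos_left hw hε.le, hε, fun x hx => by rw [hlin0 x hx, add_zero]⟩

/-- A homeomorphism commuting with all elements of `PL(I)` supported on `[0,δ]` fixes
`(0,δ)` pointwise. -/
theorem apply_eq_self_of_forall_commute {f : Homeomorph UnitInt UnitInt} {δ : ℝ} (hδ : δ ≤ 1)
    (h : ∀ k, IsPLHomeo k → (∀ x : UnitInt, δ ≤ x → k x = x) → f * k = k * f)
    {x : UnitInt} (hx0 : 0 < (x : ℝ)) (hxδ : (x : ℝ) < δ) : f x = x := by
  by_contra hne
  obtain ⟨a, b, ha, hax, hxb, hb, hfx⟩ : ∃ a b : ℝ, 0 < a ∧ a < x ∧ (x : ℝ) < b ∧ b < δ ∧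
      ((f x : ℝ) ≤ a ∨ b ≤ f x) := by
    rcases lt_or_gt_of_ne (fun h => hne (Subtype.ext h) : (f x : ℝ) ≠ x) with hlt | hlt
    · exact ⟨max (f x) (x / 2), (x + δ) / 2, lt_max_of_lt_right (by linarith),
        max_lt hlt (by linarith), by linarith, by linarith, Or.inl (le_max_left _ _)⟩
    · exact ⟨x / 2, min (f x) ((x + δ) / 2), by linarith, by linarith,
        lt_min hlt (by linarith), min_lt_of_right_lt (by linarith), Or.inr (min_le_left _ _)⟩
  obtain ⟨k, hk, hkfix, hkmov, -⟩ :=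
    exists_isPLHomeo_bump ha (hax.trans hxb) (hb.trans_le hδ) one_lt_two
  have hcomm : f (k x) = k (f x) :=
    DFunLike.congr_fun (h k hk fun y hy => hkfix y (Or.inr (hb.le.trans hy))) x
  rw [hkfix _ hfx] at hcomm
  exact (hkmov x hax hxb).ne' (f.injective hcomm)

open scoped Pointwise in
/-- In a separable topological group every neighbourhood of `1` contains a nontrivial quotient
of two members of an uncountable family. -/
theorem exists_inv_mul_mem_of_uncountable {G ι : Type*} [Group G] [TopologicalSpace G]
    [IsTopologicalGroup G] [TopologicalSpace.SeparableSpace G] (φ : ι → G) {S : Set ι}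
    (hS : ¬ S.Countable) {V : Set G} (hV : V ∈ nhds (1 : G)) :
    ∃ i ∈ S, ∃ j ∈ S, i ≠ j ∧ (φ i)⁻¹ * φ j ∈ V := by
  by_contra! hcon
  obtain ⟨W, hW, hWV⟩ : ∃ W ∈ nhds (1 : G), ∀ x ∈ W, ∀ y ∈ W, x / y ∈ V :=
    exists_nhds_split_inv hV
  refine hS (Set.PairwiseDisjoint.countable_of_nonempty_interior (s := fun i => φ i • W) ?_ ?_)
  · intro i hi j hj hij
    refine Set.disjoint_left.2 ?_
    rintro _ ⟨x, hx, rfl⟩ ⟨y, hy, hxy⟩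
    refine hcon i hi j hj hij ?_
    have : (φ i)⁻¹ * φ j = x / y := by
      rw [div_eq_mul_inv, eq_mul_inv_iff_mul_eq, mul_assoc, inv_mul_eq_iff_eq_mul]
      exact hxy
    exact this ▸ hWV x hx y hy
  · intro i _
    rw [interior_smul]
    exact ⟨_, Set.smul_mem_smul_set (mem_interior_iff_mem_nhds.2 hW)⟩

/-- The group `PL(I)` of orientation-preserving piecewise linear homeomorphisms of `[0,1]`
admits no Polish group topology: no topology making it a separable completely metrizable
topological group. -/
theorem plI_no_polish_group_topology
    (H : Subgroup (Homeomorph UnitInt UnitInt))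
    (hH : (H : Set (Homeomorph UnitInt UnitInt)) = {f | IsPLHomeo f}) :
    ¬ ∃ τ : TopologicalSpace H, @IsTopologicalGroup H τ _ ∧ @PolishSpace H τ := by
  rintro ⟨τ, hτ, hP⟩
  have hmem : ∀ {f}, f ∈ H ↔ IsPLHomeo f := fun {f} => by
    rw [← SetLike.mem_coe, hH]; rfl
  obtain ⟨d, hd, hd2⟩ := exists_isPLHomeo_doubling
  lift d to H using hmem.2 hd
  let E : ℝ → Set H := fun δ => {g | ∀ k : H, (∀ x : UnitInt, δ ≤ x → k.1 x = x) →
    g * d * g⁻¹ * d⁻¹ * k = k * (g * d * g⁻¹ * d⁻¹)}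
  have hclosed : ∀ n : ℕ, IsClosed (E (1 / (n + 1))) := fun n => by
    simp only [E, Set.ofPred_forall]
    exact isClosed_iInter fun k => isClosed_iInter fun _ =>
      isClosed_eq (by fun_prop) (by fun_prop)
  have hcover : ⋃ n : ℕ, E (1 / (n + 1)) = Set.univ := by
    refine Set.eq_univ_of_forall fun g => Set.mem_iUnion.2 ?_
    obtain ⟨c, ε, hc, hε, hg⟩ := (hmem.1 g.2).exists_linear_near_zero
    obtain ⟨η, hη, hηε, hη3, hηc⟩ : ∃ η : ℝ, 0 < η ∧ η ≤ ε / 2 ∧ η ≤ 1 / 3 ∧ η ≤ 1 / 3 / c :=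
      ⟨min (ε / 2) (min (1 / 3) (1 / 3 / c)), by positivity, min_le_left _ _,
        (min_le_right _ _).trans (min_le_left _ _), (min_le_right _ _).trans (min_le_right _ _)⟩
    rw [le_div_iff₀ hc] at hηc
    have hlin : ∀ x : UnitInt, (x : ℝ) ≤ η → d.1 (g.1 x) = g.1 (d.1 x) := fun x hx => by
      apply Subtype.ext
      have hx2 : (d.1 x : ℝ) = 2 * x := hd2 x (hx.trans hη3)
      have hgx : (g.1 x : ℝ) = c * x := hg x (by linarith)
      rw [hg (d.1 x) (by linarith), hd2 (g.1 x) (by nlinarith), hx2, hgx]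
      ring
    let w : UnitInt := ⟨η, hη.le, by linarith⟩
    have hw : (d.1 (g.1 w) : ℝ) = 2 * (c * η) := by
      have hgw : (g.1 w : ℝ) = c * η := hg w (by change η ≤ ε; linarith)
      rw [hd2 (g.1 w) (by nlinarith), hgw]
    obtain ⟨n, hn⟩ := exists_nat_one_div_lt (show 0 < 2 * (c * η) by positivity)
    refine ⟨n, fun k hk => ?_⟩
    have hfix : ∀ y : UnitInt, (y : ℝ) ≤ 1 / (n + 1) → (g * d * g⁻¹ * d⁻¹).1 y = y := by
      intro y hy
      obtain ⟨x, rfl⟩ := ((d * g : H).1).surjective y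
      have hdg : (g * d * g⁻¹ * d⁻¹) * (d * g) = g * d := by group
      have hx : (x : ℝ) ≤ η := by
        by_contra! hlt
        have h1 : d.1 (g.1 w) < d.1 (g.1 x) :=
          (hmem.1 d.2).1 ((hmem.1 g.2).1 (show w < x from hlt))
        have h2 : (d.1 (g.1 w) : ℝ) < d.1 (g.1 x) := h1
        have h3 : (d.1 (g.1 x) : ℝ) ≤ 1 / (n + 1) := hy
        linarith
      exact (congrArg (fun u : H => u.1 x) hdg).trans (hlin x hx).symm
    set f := g * d * g⁻¹ * d⁻¹
    apply Subtype.ext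
    apply Homeomorph.ext
    intro x
    change f.1 (k.1 x) = k.1 (f.1 x)
    rcases le_total (1 / (n + 1) : ℝ) x with hx | hx
    · have hfx : (1 / (n + 1) : ℝ) ≤ f.1 x := by
        by_contra! hlt
        have := f.1.injective (hfix _ hlt.le)
        rw [this] at hlt
        linarith
      rw [hk x hx, hk _ hfx]
    · have hkx : (k.1 x : ℝ) ≤ 1 / (n + 1) := by
        by_contra! hlt
        have := k.1.injective (hk _ hlt.le)
        rw [this] at hlt
        linarith
      rw [hfix x hx, hfix _ hkx]
  obtain ⟨n, g, hg⟩ := nonempty_interior_of_iUnion_of_closed hclosed hcover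
  have hδ1 : (1 / (n + 1) : ℝ) ≤ 1 := by
    rw [div_le_one (by positivity)]
    linarith [n.cast_nonneg (α := ℝ)]
  have hδ0 : (0 : ℝ) < 1 / (n + 1) := by positivity
  set δ : ℝ := 1 / (n + 1)
  have hV : {h : H | g * h ∈ E δ} ∈ nhds (1 : H) :=
    (continuous_const_mul g).continuousAt.preimage_mem_nhds
      (by rw [mul_one]; exact mem_interior_iff_mem_nhds.1 hg)
  obtain ⟨c, ε, hc, hε, hgc⟩ := (hmem.1 g.2).exists_linear_near_zero
  obtain ⟨b, hb0, hbε, hb3, hbc⟩ : ∃ b : ℝ, 0 < b ∧ b ≤ ε / 2 ∧ b ≤ 1 / 3 ∧ b ≤ δ / 3 / c :=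
    ⟨min (ε / 2) (min (1 / 3) (δ / 3 / c)), by positivity, min_le_left _ _,
      (min_le_right _ _).trans (min_le_left _ _), (min_le_right _ _).trans (min_le_right _ _)⟩
  rw [le_div_iff₀ hc] at hbc
  have hbump : ∀ s : ℝ, ∃ f : H, 1 < s →
      (∀ x : UnitInt, (x : ℝ) ≤ 3 / 4 * b ∨ b ≤ x → f.1 x = x) ∧
      ∀ x : UnitInt, 3 / 4 * b ≤ x → (x : ℝ) ≤ (b + 3 / 4 * b * s) / (s + 1) →
        (f.1 x : ℝ) = 3 / 4 * b + s * (x - 3 / 4 * b) := by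
    intro s
    by_cases hs : 1 < s
    · obtain ⟨f, hf, h1, -, h2⟩ := exists_isPLHomeo_bump (a := 3 / 4 * b) (b := b) (s := s)
        (by linarith) (by linarith) (by linarith) hs
      exact ⟨⟨f, hmem.2 hf⟩, fun _ => ⟨h1, h2⟩⟩
    · exact ⟨1, fun h => absurd h hs⟩
  choose φ hφ using hbump
  obtain ⟨s, hs, t, ht, hst, hmemV⟩ := exists_inv_mul_mem_of_uncountable φ
    (S := Set.Ioi (1 : ℝ)) (fun hS => Cardinal.aleph0_lt_continuum.not_ge
      (Cardinal.mk_Ioi_real 1 ▸ Cardinal.le_aleph0_iff_set_countable.2 hS)) hV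
  set h := (φ s)⁻¹ * φ t with hh
  have hfix : ∀ x : UnitInt, (x : ℝ) ≤ 3 / 4 * b ∨ b ≤ x → h.1 x = x := fun x hx => by
    apply (φ s).1.injective
    have e : φ s * h = φ t := by rw [hh]; group
    have e' : (φ s).1 (h.1 x) = (φ t).1 x := congrArg (fun u : H => u.1 x) e
    rw [e', (hφ t ht).1 x hx, (hφ s hs).1 x hx]
  have hid : ∀ x : UnitInt, 3 / 4 * b < x → (x : ℝ) < b → h.1 x = x := by
    intro x hax hxb
    have hhb : (h.1 x : ℝ) < b := by
      by_contra! hle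
      have := h.1.injective (hfix _ (Or.inr hle))
      rw [this] at hle
      linarith
    have hha : (0 : ℝ) < h.1 x := by
      by_contra! hle
      have := h.1.injective (hfix _ (Or.inl (hle.trans (by positivity))))
      rw [this] at hle
      linarith
    have hdx : (d.1 x : ℝ) = 2 * x := hd2 x (by linarith)
    have hghx : (g.1 (h.1 x) : ℝ) = c * h.1 x := hgc _ (by linarith)
    have hdgh : (d.1 (g.1 (h.1 x)) : ℝ) = 2 * (c * h.1 x) := by
      rw [hd2 (g.1 (h.1 x)) (by nlinarith), hghx]
    have hghd : (g.1 (h.1 (d.1 x)) : ℝ) = c * (2 * x) := by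
      rw [hfix (d.1 x) (Or.inr (by linarith)), hgc _ (by linarith), hdx]
    set f := g * h * d * (g * h)⁻¹ * d⁻¹ with hf
    have hfy := apply_eq_self_of_forall_commute (f := f.1) hδ1
      (fun k hk hkδ => congrArg Subtype.val (hmemV ⟨k, hmem.2 hk⟩ hkδ))
      (x := d.1 (g.1 (h.1 x))) (by rw [hdgh]; positivity) (by rw [hdgh]; nlinarith)
    have e : f * (d * (g * h)) = g * h * d := by rw [hf]; group
    have e' : f.1 (d.1 (g.1 (h.1 x))) = g.1 (h.1 (d.1 x)) := congrArg (fun u : H => u.1 x) e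
    rw [e'] at hfy
    have := congrArg Subtype.val hfy
    rw [hghd, hdgh] at this
    exact Subtype.ext (mul_left_cancel₀ hc.ne' (by linarith))
  have heq : ∀ x : UnitInt, (φ s).1 x = (φ t).1 x := fun x => by
    have hx : h.1 x = x := by
      by_cases hx : (x : ℝ) ≤ 3 / 4 * b ∨ b ≤ x
      · exact hfix x hx
      · push Not at hx
        exact hid x hx.1 hx.2
    have e : φ s * h = φ t := by rw [hh]; group
    have e' : (φ s).1 (h.1 x) = (φ t).1 x := congrArg (fun u : H => u.1 x) e
    rw [← e', hx]
  obtain ⟨x, hax, hxs, hxt⟩ : ∃ x : UnitInt, 3 / 4 * b < x ∧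
      (x : ℝ) ≤ (b + 3 / 4 * b * s) / (s + 1) ∧ (x : ℝ) ≤ (b + 3 / 4 * b * t) / (t + 1) := by
    rw [Set.mem_Ioi] at hs ht
    have key : ∀ u : ℝ, 1 < u → 3 / 4 * b < (b + 3 / 4 * b * u) / (u + 1) := fun u hu => by
      rw [lt_div_iff₀ (by linarith)]; linarith
    have key' : (b + 3 / 4 * b * s) / (s + 1) ≤ 1 := by
      rw [div_le_one (by linarith)]; nlinarith
    exact ⟨⟨min ((b + 3 / 4 * b * s) / (s + 1)) ((b + 3 / 4 * b * t) / (t + 1)),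
      le_min (by linarith [key s hs]) (by linarith [key t ht]), min_le_of_left_le key'⟩,
      lt_min (key s hs) (key t ht), min_le_left _ _, min_le_right _ _⟩
  have hval := congrArg Subtype.val (heq x)
  rw [(hφ s hs).2 x hax.le hxs, (hφ t ht).2 x hax.le hxt] at hval
  exact hst (mul_right_cancel₀ (sub_pos.2 hax).ne' (add_left_cancel hval))
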